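/- Let c ≥ 1 and let t satisfy 1 ≤ t ≤ min(2^{h(c−1)}, |V|). Then the constant vector (1/(c+1), …, 1/(c+1)) ∈ ℝ^V lies in P^t, and its total profit is ∑_{v ∈ V} w_v/(c+1) = h/(c+1). (Combined with the fact that every routable set in T^h_FG has profit at most 2, this shows the integrality gap of P^t on Friggstad–Gao instances is at least h/(2(c+1)).) -/

import Mathlib

open Finset

/-- The vertex/request set of the Friggstad–Gao instance `T^h_FG`: sequences over
`{1,…,2^{h-1}}` of length at most `h-1`, encoded as a pair of a length `< h`
together with a tuple of that length. -/
abbrev FGV (h : ℕ) : Type := Σ k : Fin h, (Fin (k : ℕ) → Fin (2 ^ (h - 1)))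

/-- The level of a vertex: its length plus one. -/
def FGlevel {h : ℕ} (v : FGV h) : ℕ := (v.1 : ℕ) + 1

/-- The prefix order `v ⪯ w` on sequences. -/
def FGprefix {h : ℕ} (v w : FGV h) : Prop :=
  (v.1 : ℕ) ≤ (w.1 : ℕ) ∧
    ∀ i : Fin (v.1 : ℕ), ∀ j : Fin (w.1 : ℕ), (i : ℕ) = (j : ℕ) → w.2 j = v.2 i

instance {h : ℕ} (v w : FGV h) : Decidable (FGprefix v w) := by
  unfold FGprefix; infer_instance

/-- The demand of a level-`ℓ` request: `2^{h(h-ℓ+1)} - 2^{h(h-ℓ)}`. -/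
def FGdemand {h : ℕ} (v : FGV h) : ℝ :=
  2 ^ (h * (h - FGlevel v + 1)) - 2 ^ (h * (h - FGlevel v))

/-- The capacity of the parent edge `e_v` of a level-`ℓ` vertex: `2^{h(h-ℓ+1)}`. -/
def FGcap {h : ℕ} (v : FGV h) : ℝ := 2 ^ (h * (h - FGlevel v + 1))

/-- The profit of a level-`ℓ` request: `2^{-(h-1)(ℓ-1)}`. -/
noncomputable def FGprofit {h : ℕ} (v : FGV h) : ℝ :=
  (2 : ℝ) ^ (-(((h - 1) * (FGlevel v - 1) : ℕ) : ℤ))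

/-- `X` is routable on the edge `e_v`. -/
def RoutableOn {h : ℕ} (X : Finset (FGV h)) (v : FGV h) : Prop :=
  ∑ w ∈ X.filter (fun w => FGprefix v w), FGdemand w ≤ FGcap v

/-- `X` is `S`-routable. -/
def SRoutable {h : ℕ} (X S : Finset (FGV h)) : Prop :=
  ∀ v ∈ S, RoutableOn X v

/-- `X` is routable. -/
def Routable {h : ℕ} (X : Finset (FGV h)) : Prop :=
  ∀ v : FGV h, RoutableOn X v

/-- `K_I(S)` for the Friggstad–Gao instance: the convex hull of indicator
vectors of `S`-routable sets. -/
def FGKI {h : ℕ} (S : Finset (FGV h)) : Set (FGV h → ℝ) :=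
  convexHull ℝ
    {x | ∃ X : Finset (FGV h), SRoutable X S ∧ x = fun w => if w ∈ X then (1 : ℝ) else 0}

/-- `P^t` for the Friggstad–Gao instance. -/
def FGP (h t : ℕ) : Set (FGV h → ℝ) :=
  ⋂ S ∈ {S : Finset (FGV h) | S.card = t}, FGKI S

lemma FGdemand_eq {h : ℕ} (v : FGV h) :
    FGdemand v = 2 ^ (h * (h - (v.1 : ℕ))) - 2 ^ (h * (h - (v.1 : ℕ) - 1)) := by
  have hv := v.1.isLt
  have h₁ : h - FGlevel v + 1 = h - (v.1 : ℕ) := by unfold FGlevel; omega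
  have h₂ : h - FGlevel v = h - (v.1 : ℕ) - 1 := by unfold FGlevel; omega
  unfold FGdemand
  rw [h₁, h₂]

lemma FGcap_eq {h : ℕ} (v : FGV h) : FGcap v = 2 ^ (h * (h - (v.1 : ℕ))) := by
  have hv := v.1.isLt
  have h₁ : h - FGlevel v + 1 = h - (v.1 : ℕ) := by unfold FGlevel; omega
  unfold FGcap
  rw [h₁]

lemma FGdemand_nonneg {h : ℕ} (v : FGV h) : 0 ≤ FGdemand v := by
  rw [FGdemand_eq, sub_nonneg]
  exact pow_le_pow_right₀ (by norm_num) (Nat.mul_le_mul_left _ (Nat.sub_le _ _))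

lemma FGdemand_le {h : ℕ} (v : FGV h) : FGdemand v ≤ 2 ^ (h * (h - (v.1 : ℕ))) := by
  rw [FGdemand_eq]
  exact sub_le_self _ (by positivity)

/-- Two comparable vertices of equal length coincide. -/
lemma FGprefix.eq_of_length {h : ℕ} {v w : FGV h} (hp : FGprefix v w)
    (hl : (v.1 : ℕ) = w.1) : v = w := by
  obtain ⟨k, a⟩ := v
  obtain ⟨m, b⟩ := w
  obtain rfl : k = m := Fin.ext hl
  congr 1
  funext i
  exact (hp.2 i i rfl).symm

lemma card_descendants_le {h : ℕ} (v : FGV h) (m : Fin h) :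
    (univ.filter fun b : Fin (m : ℕ) → Fin (2 ^ (h - 1)) => FGprefix v ⟨m, b⟩).card
      ≤ 2 ^ ((h - 1) * ((m : ℕ) - v.1)) := by
  have hcard : (univ : Finset (Fin ((m : ℕ) - v.1) → Fin (2 ^ (h - 1)))).card
      = 2 ^ ((h - 1) * ((m : ℕ) - v.1)) := by
    simp [← pow_mul]
  rw [← hcard]
  refine card_le_card_of_injOn
    (fun b i => b ⟨(v.1 : ℕ) + i, by omega⟩) (fun _ _ => mem_coe.2 (mem_univ _)) ?_
  intro b hb b' hb' hbb
  have hb := (mem_filter.1 (mem_coe.1 hb)).2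
  have hb' := (mem_filter.1 (mem_coe.1 hb')).2
  funext j
  by_cases hj : (j : ℕ) < v.1
  · exact (hb.2 ⟨j, hj⟩ j rfl).trans (hb'.2 ⟨j, hj⟩ j rfl).symm
  · have hj' := congrFun hbb ⟨(j : ℕ) - v.1, by omega⟩
    have he : (⟨(v.1 : ℕ) + ((j : ℕ) - v.1), by omega⟩ : Fin (m : ℕ)) = j :=
      Fin.ext (by simp; omega)
    simpa only [he] using hj'

lemma sum_half_pow_le (k h : ℕ) :
    ∑ m ∈ (range h).filter (k < ·), (1 / 2 : ℝ) ^ (m - k) ≤ 1 := by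
  have hI : (range h).filter (k < ·) = Ico (k + 1) h := by
    ext m
    simp only [mem_filter, mem_range, mem_Ico]
    omega
  rw [hI, sum_Ico_eq_sum_range]
  have hs : ∀ i ∈ range (h - (k + 1)),
      (1 / 2 : ℝ) ^ (k + 1 + i - k) = (1 / 2) * (1 / 2) ^ i := by
    intro i _
    rw [show k + 1 + i - k = i + 1 by omega, pow_succ']
  rw [sum_congr rfl hs, ← mul_sum]
  linarith [sum_geometric_two_le (h - (k + 1))]

/-- The strict descendants of `v` fit together on the edge `e_v`. -/
lemma sum_strict_descendants_le {h : ℕ} (v : FGV h) :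
    ∑ w ∈ univ.filter (fun w => FGprefix v w ∧ w ≠ v), FGdemand w ≤ FGcap v := by
  have hlevel : ∀ m : Fin h,
      (∑ b : Fin (m : ℕ) → Fin (2 ^ (h - 1)),
        if FGprefix v ⟨m, b⟩ ∧ (⟨m, b⟩ : FGV h) ≠ v then FGdemand (⟨m, b⟩ : FGV h) else 0)
      ≤ if (v.1 : ℕ) < m then FGcap v * (1 / 2) ^ ((m : ℕ) - v.1) else 0 := by
    intro m
    split_ifs with hm
    · have hexp : (2 : ℝ) ^ ((h - 1) * ((m : ℕ) - v.1)) * 2 ^ (h * (h - (m : ℕ)))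
          = FGcap v * (1 / 2) ^ ((m : ℕ) - v.1) := by
        obtain ⟨d, hd⟩ : ∃ d, (m : ℕ) = v.1 + d := ⟨m - v.1, by omega⟩
        obtain ⟨e, he⟩ : ∃ e, h = m + e := ⟨h - m, by omega⟩
        obtain ⟨g, hg⟩ : ∃ g, h = g + 1 := ⟨h - 1, by omega⟩
        rw [FGcap_eq, show (m : ℕ) - v.1 = d by omega, show h - (m : ℕ) = e by omega,
          show h - (v.1 : ℕ) = d + e by omega, show h - 1 = g by omega,
          one_div, inv_pow, eq_mul_inv_iff_mul_eq₀ (by positivity), ← pow_add, ← pow_add, hg]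
        congr 1
        ring
      rw [← hexp, ← sum_filter]
      refine (sum_le_card_nsmul _ _ (2 ^ (h * (h - (m : ℕ)))) fun b _ => FGdemand_le _).trans ?_
      rw [nsmul_eq_mul]
      refine mul_le_mul_of_nonneg_right ?_ (by positivity)
      have hc := (card_le_card (monotone_filter_right univ
        (p := fun b => FGprefix v ⟨m, b⟩ ∧ (⟨m, b⟩ : FGV h) ≠ v)
        (q := fun b => FGprefix v ⟨m, b⟩) fun b _ hb => hb.1)).trans (card_descendants_le v m)
      exact_mod_cast hc
    · refine (sum_eq_zero fun b _ => if_neg ?_).le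
      rintro ⟨hp, hne⟩
      exact hne (hp.eq_of_length (le_antisymm hp.1 (not_lt.1 hm))).symm
  rw [sum_filter, Fintype.sum_sigma]
  refine (sum_le_sum fun m _ => hlevel m).trans ?_
  rw [Fin.sum_univ_eq_sum_range
    (fun m => if (v.1 : ℕ) < m then FGcap v * (1 / 2 : ℝ) ^ (m - (v.1 : ℕ)) else 0) h,
    ← sum_filter, ← mul_sum]
  refine mul_le_of_le_one_right ?_ (sum_half_pow_le _ _)
  rw [FGcap_eq]
  positivity

lemma RoutableOn.of_notMem {h : ℕ} {X : Finset (FGV h)} {v : FGV h} (hv : v ∉ X) :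
    RoutableOn X v := by
  refine (sum_le_sum_of_subset_of_nonneg ?_ fun w _ _ => FGdemand_nonneg w).trans
    (sum_strict_descendants_le v)
  intro w hw
  rw [mem_filter] at hw ⊢
  exact ⟨mem_univ _, hw.2, fun he => hv (he ▸ hw.1)⟩

/-- A small set whose lengths are congruent modulo `c` is routable. -/
lemma RoutableOn.of_length_mod {h c r : ℕ} (hc : 1 ≤ c) {X : Finset (FGV h)}
    (hcard : X.card ≤ 2 ^ (h * (c - 1))) (hX : ∀ w ∈ X, (w.1 : ℕ) % c = r) {v : FGV h}
    (hv : v ∈ X) : RoutableOn X v := by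
  unfold RoutableOn
  have hvf : v ∈ X.filter (fun w => FGprefix v w) :=
    mem_filter.2 ⟨hv, le_rfl, fun i j hij => by rw [Fin.ext hij]⟩
  rw [← add_sum_erase _ _ hvf]
  have hle : ∀ w ∈ (X.filter (fun w => FGprefix v w)).erase v,
      FGdemand w ≤ 2 ^ (h * (h - (v.1 : ℕ) - 1)) / 2 ^ (h * (c - 1)) := by
    intro w hw
    obtain ⟨hne, hw⟩ := mem_erase.1 hw
    obtain ⟨hwX, hp⟩ := mem_filter.1 hw
    have hlt : (v.1 : ℕ) < w.1 :=
      lt_of_le_of_ne hp.1 fun he => hne (hp.eq_of_length he).symm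
    have hdvd : c ∣ (w.1 : ℕ) - v.1 :=
      (Nat.modEq_iff_dvd' hp.1).1 ((hX v hv).trans (hX w hwX).symm)
    have hcle := Nat.le_of_dvd (by omega) hdvd
    have hwh := w.1.isLt
    refine (FGdemand_le w).trans ?_
    rw [le_div_iff₀ (by positivity), ← pow_add, ← mul_add]
    exact pow_le_pow_right₀ (by norm_num) (Nat.mul_le_mul_left _ (by omega))
  have hrest : ∑ w ∈ (X.filter (fun w => FGprefix v w)).erase v, FGdemand w
      ≤ 2 ^ (h * (h - (v.1 : ℕ) - 1)) := by
    refine (sum_le_card_nsmul _ _ _ hle).trans ?_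
    rw [nsmul_eq_mul, mul_div_assoc', div_le_iff₀ (by positivity), mul_comm]
    refine mul_le_mul_of_nonneg_left ?_ (by positivity)
    exact_mod_cast (card_le_card ((erase_subset _ _).trans (filter_subset _ _))).trans hcard
  rw [FGdemand_eq, FGcap_eq]
  linarith

/-- If `V` is partitioned into `n` sets that are all `S`-routable, then `K_I(S)` contains the
constant vector `1/n`. -/
lemma const_mem_FGKI {h n : ℕ} (hn : n ≠ 0) {S : Finset (FGV h)} (f : FGV h → ℕ)
    (hf : ∀ w, f w < n) (hS : ∀ i, SRoutable (univ.filter (f · = i)) S) :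
    (fun _ => 1 / (n : ℝ)) ∈ FGKI S := by
  have hn' : (n : ℝ) ≠ 0 := Nat.cast_ne_zero.2 hn
  have hmem := (convex_convexHull ℝ
      {x | ∃ X : Finset (FGV h), SRoutable X S ∧ x = fun w => if w ∈ X then (1 : ℝ) else 0}).sum_mem
    (t := range n) (w := fun _ => 1 / (n : ℝ))
    (z := fun i w => if w ∈ univ.filter (f · = i) then (1 : ℝ) else 0)
    (fun _ _ => by positivity) (by simp [hn'])
    (fun i _ => subset_convexHull ℝ _ ⟨_, hS i, rfl⟩)
  unfold FGKI
  convert hmem using 1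
  funext w
  simp [Finset.sum_apply, hf w]

lemma const_mem_FGP {h c t : ℕ} (hc : 1 ≤ c) (ht : t ≤ 2 ^ (h * (c - 1))) :
    (fun _ : FGV h => 1 / ((c : ℝ) + 1)) ∈ FGP h t := by
  refine Set.mem_iInter₂.2 fun S hS => ?_
  have hS : S.card = t := hS
  have hmod : ∀ w : FGV h, (w.1 : ℕ) % c < c := fun w => Nat.mod_lt _ hc
  have hmem := const_mem_FGKI (n := c + 1) (by omega) (S := S)
    (fun w => if w ∈ S then (w.1 : ℕ) % c else c)
    (fun w => by have := hmod w; split_ifs <;> omega) ?_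
  · simpa using hmem
  intro i v hvS
  by_cases hvX : v ∈ univ.filter (fun w : FGV h => (if w ∈ S then (w.1 : ℕ) % c else c) = i)
  · have hi : (v.1 : ℕ) % c = i := by simpa [hvS] using hvX
    have hsub : ∀ w ∈ univ.filter (fun w : FGV h => (if w ∈ S then (w.1 : ℕ) % c else c) = i),
        w ∈ S ∧ (w.1 : ℕ) % c = i := by
      intro w hw
      have hw := (mem_filter.1 hw).2
      have := hmod v
      split_ifs at hw with hwS
      · exact ⟨hwS, hw⟩
      · omega
    refine RoutableOn.of_length_mod hc ?_ (fun w hw => (hsub w hw).2) hvX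
    exact (card_le_card fun w hw => (hsub w hw).1).trans (hS.trans_le ht)
  · exact RoutableOn.of_notMem hvX

lemma sum_FGprofit (h : ℕ) : ∑ v : FGV h, FGprofit v = h := by
  rw [Fintype.sum_sigma]
  have hlevel : ∀ m : Fin h,
      ∑ b : Fin (m : ℕ) → Fin (2 ^ (h - 1)), FGprofit (⟨m, b⟩ : FGV h) = 1 := by
    intro m
    simp only [FGprofit, FGlevel, Nat.add_sub_cancel, sum_const, card_univ, Fintype.card_fun,
      Fintype.card_fin, nsmul_eq_mul, zpow_neg, zpow_natCast, ← pow_mul]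
    push_cast
    exact mul_inv_cancel₀ (by positivity)
  simp [hlevel]

theorem fg_lower_bound (h : ℕ) (hh : 2 ≤ h) (c : ℕ) (hc : 1 ≤ c)
    (t : ℕ) (ht1 : 1 ≤ t)
    (ht : t ≤ min (2 ^ (h * (c - 1))) (Fintype.card (FGV h))) :
    (fun _ : FGV h => (1 / ((c : ℝ) + 1))) ∈ FGP h t ∧
    ∑ v : FGV h, FGprofit v * (1 / ((c : ℝ) + 1)) = (h : ℝ) / ((c : ℝ) + 1) := by
  refine ⟨const_mem_FGP hc (ht.trans (min_le_left _ _)), ?_⟩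
  rw [← sum_mul, sum_FGprofit, mul_one_div]
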